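/- Let I₁, I₃ be real numbers, and let ω, n : ℝ → ℝ³ be differentiable functions with n′(t) = ω(t) × n(t) for all t. Define L(t) = I₁ ω(t) + (I₃ − I₁)(ω(t) · n(t)) n(t). Then for all t, ω′(t) · L(t) = ω(t) · L′(t). -/

import Mathlib

open Matrix

theorem HasDerivAt.dotProduct {ι : Type*} [Fintype ι] {u v : ℝ → ι → ℝ} {u' v' : ι → ℝ} {t : ℝ}
    (hu : HasDerivAt u u' t) (hv : HasDerivAt v v' t) :
    HasDerivAt (fun s => u s ⬝ᵥ v s) (u' ⬝ᵥ v t + u t ⬝ᵥ v') t := by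
  simp only [_root_.dotProduct, ← Finset.sum_add_distrib]
  exact HasDerivAt.fun_sum fun i _ => (hasDerivAt_pi.1 hu i).mul (hasDerivAt_pi.1 hv i)

/-- If `n′ = ω × n` and `L = I₁ ω + (I₃ − I₁)(ω · n) n`, then
`ω′ · L = ω · L′`. -/
theorem stmt_6 (I₁ I₃ : ℝ) (ω n : ℝ → Fin 3 → ℝ)
    (hω : Differentiable ℝ ω) (hn : Differentiable ℝ n)
    (hndot : ∀ t, deriv n t = crossProduct (ω t) (n t))
    (L : ℝ → Fin 3 → ℝ)
    (hL : ∀ t, L t = I₁ • ω t + (I₃ - I₁) • ((ω t ⬝ᵥ n t) • n t)) :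
    ∀ t, deriv ω t ⬝ᵥ L t = ω t ⬝ᵥ deriv L t := by
  intro t
  have hω' := (hω t).hasDerivAt
  have hn' := (hn t).hasDerivAt
  have horth : ω t ⬝ᵥ deriv n t = 0 := by rw [hndot, dot_self_cross]
  have hL' : HasDerivAt L _ t :=
    ((hω'.const_smul I₁).add
      (((hω'.dotProduct hn').smul hn').const_smul (I₃ - I₁))).congr_of_eventuallyEq
        (.of_forall hL)
  rw [hL'.deriv, hL]
  simp only [dotProduct_add, dotProduct_smul, horth, smul_eq_mul]
  rw [dotProduct_comm (deriv ω t) (ω t)]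
  ring
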